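/- arXiv:2410.01025 — 2 statements merged into one kernel-verified Lean document; each statement's English description precedes it below -/
import Mathlib

section
/- For every β > 2 the constant 𝒵_β = 2π ∫_0^∞ exp(β g_1(r)) r dr is finite and positive, and for every λ > 0, ∫_{ℝ²} exp( β g_λ(u) ) du = λ^{2−β} 𝒵_β. -/
open MeasureTheory Real
open scoped ENNReal NNReal BigOperators Classical

noncomputable section

/-- The plane `ℝ²`. -/
abbrev E2 := EuclideanSpace ℝ (Fin 2)

/-- The logarithmic Coulomb kernel `g(x) = -log |x|`. -/
def gfun (x : E2) : ℝ := -Real.log ‖x‖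

/-- The uniform probability measure on the closed ball `B(z, lam)` (smeared charge). -/
def udisc (z : E2) (lam : ℝ) : MeasureTheory.Measure E2 :=
  (MeasureTheory.volume (Metric.closedBall z lam))⁻¹ •
    MeasureTheory.volume.restrict (Metric.closedBall z lam)

/-- The smeared interaction `g_lam(z) = ∬ g(x-y) dδ_0^{(lam)}(x) dδ_z^{(lam)}(y)`. -/
def gsm (lam : ℝ) (z : E2) : ℝ :=
  ∫ x, (∫ y, gfun (x - y) ∂(udisc z lam)) ∂(udisc 0 lam)

/-- `κ = g_1(0)`. -/
def kappa : ℝ := gsm 1 0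

/-- The (renormalized) energy `F_lam(X_N, Y_N)`. -/
def Flam (N : ℕ) (lam : ℝ) (X Y : Fin N → E2) : ℝ :=
  (1/2) * (∑ i : Fin N, ∑ j : Fin N,
      (gsm lam (X i - X j) + gsm lam (Y i - Y j) - 2 * gsm lam (X i - Y j)))
    - N * (-Real.log lam + kappa)

/-- The box `Λ = [0, √N]²`. -/
def LamBox (N : ℕ) : Set E2 := {x | ∀ i, x i ∈ Set.Icc (0:ℝ) (Real.sqrt N)}

/-- The configuration space `Λ^N × Λ^N`. -/
def confSet (N : ℕ) : Set ((Fin N → E2) × (Fin N → E2)) :=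
  {P | (∀ i, P.1 i ∈ LamBox N) ∧ (∀ i, P.2 i ∈ LamBox N)}

/-- The partition function `Z_{N,β}^{lam}`. -/
def Zpart (N : ℕ) (β lam : ℝ) : ℝ :=
  ∫ P in confSet N, Real.exp (-β * Flam N lam P.1 P.2)

/-- `g_1` evaluated at (any) point of norm `r` (it is radial). -/
def g1rad (r : ℝ) : ℝ := gsm 1 (EuclideanSpace.single (0 : Fin 2) r)

/-- The constant `𝒵_β`. -/
def Zbeta (β : ℝ) : ℝ :=
  if β = 2 then 2 * Real.pi
  else 2 * Real.pi * ∫ r in Set.Ioi (0:ℝ), Real.exp (β * g1rad r) * r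

/-- The error rate `ω_lam` (with `M₀ = 36`). -/
def omegaL (β lam : ℝ) : ℝ :=
  if β = 2 then |Real.log lam| ^ (-(1:ℝ)/(5+36))
  else if β < 4 then lam ^ ((2*(β-2))/(12-β+36))
  else if β = 4 then (lam * |Real.log lam|) ^ ((1:ℝ)/(2+36))
  else lam ^ ((1:ℝ)/(2+36))

/-- A measurable map which multiplies the volume by a constant and pulls balls back to balls
transports uniform measures on balls. -/
lemma map_udisc {e : E2 → E2} (he : Measurable e) {c : ℝ≥0∞} (hc : c ≠ 0) (hc' : c ≠ ∞)
    (hmap : volume.map e = c • volume) {z w : E2} {r s : ℝ}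
    (hpre : e ⁻¹' Metric.closedBall w s = Metric.closedBall z r) :
    (udisc z r).map e = udisc w s := by
  have hvol : volume (Metric.closedBall z r) = c * volume (Metric.closedBall w s) := by
    rw [← hpre, ← Measure.map_apply he measurableSet_closedBall, hmap]
    rfl
  unfold udisc
  rw [Measure.map_smul, ← hpre, ← Measure.restrict_map he measurableSet_closedBall, hmap,
    Measure.restrict_smul, smul_smul, hpre, hvol, ENNReal.mul_inv (Or.inl hc) (Or.inl hc'),
    mul_right_comm, ENNReal.inv_mul_cancel hc hc', one_mul]

lemma map_add_right_udisc (z : E2) (r : ℝ) : (udisc 0 r).map (· + z) = udisc z r := by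
  refine map_udisc (measurable_add_const z) one_ne_zero ENNReal.one_ne_top ?_ ?_
  · rw [one_smul, map_add_right_eq_self]
  · ext x
    simp [dist_eq_norm]

lemma map_smul_udisc {r : ℝ} (hr : 0 < r) : (udisc 0 1).map (r • ·) = udisc 0 r := by
  refine map_udisc (measurable_const_smul r) (c := ENNReal.ofReal |(r ^ Module.finrank ℝ E2)⁻¹|)
    ?_ ENNReal.ofReal_ne_top (Measure.map_addHaar_smul volume hr.ne') ?_
  · exact (ENNReal.ofReal_pos.2 (by positivity)).ne'
  · ext x
    simp [norm_smul, abs_of_pos hr, hr]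

lemma map_linearIsometryEquiv_udisc (A : E2 ≃ₗᵢ[ℝ] E2) (r : ℝ) :
    (udisc 0 r).map A = udisc 0 r := by
  refine map_udisc A.continuous.measurable one_ne_zero ENNReal.one_ne_top ?_ ?_
  · rw [one_smul, A.measurePreserving.map_eq]
  · ext x
    simp

instance isProbabilityMeasure_udisc_zero_one : IsProbabilityMeasure (udisc 0 1) := by
  constructor
  have h0 : volume (Metric.closedBall (0 : E2) 1) ≠ 0 :=
    (Metric.measure_closedBall_pos volume _ one_pos).ne'
  have h1 : volume (Metric.closedBall (0 : E2) 1) ≠ ∞ := measure_closedBall_lt_top.ne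
  rw [udisc, Measure.smul_apply, Measure.restrict_apply_univ, smul_eq_mul,
    ENNReal.inv_mul_cancel h0 h1]

lemma udisc_absolutelyContinuous (z : E2) (r : ℝ) : udisc z r ≪ volume :=
  Measure.smul_absolutelyContinuous.trans Measure.absolutelyContinuous_restrict

lemma ae_norm_le_one : ∀ᵐ x ∂(udisc 0 1), ‖x‖ ≤ 1 := by
  refine Measure.ae_smul_measure ?_ _
  filter_upwards [ae_restrict_mem measurableSet_closedBall] with x hx
  simpa using hx

lemma integrable_udisc_of_integrable {f : E2 → ℝ} (hf : Integrable f) :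
    Integrable f (udisc 0 1) :=
  hf.restrict.smul_measure
    (ENNReal.inv_ne_top.2 (Metric.measure_closedBall_pos volume _ one_pos).ne')

lemma measurable_gfun : Measurable gfun := by
  unfold gfun
  fun_prop

lemma integrable_max_gfun_zero : Integrable (fun x : E2 => max (gfun x) 0) := by
  have h := (integrable_fun_norm_addHaar (volume : Measure E2)
    (f := fun t : ℝ => max (-Real.log t) 0)).2 ?_
  · exact h
  · rw [finrank_euclideanSpace_fin, ← Set.Ioc_union_Ioi_eq_Ioi (zero_le_one' ℝ)]
    refine IntegrableOn.union ?_ ?_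
    · have hc : Continuous fun t : ℝ => max (-(t * Real.log t)) 0 :=
        Real.continuous_mul_log.neg.max continuous_const
      refine (hc.integrableOn_Ioc (a := 0) (b := 1)).congr_fun (fun t ht => ?_) measurableSet_Ioc
      simp only [smul_eq_mul]
      rw [mul_max_of_nonneg _ _ (by simpa using ht.1.le)]
      simp
    · refine (integrableOn_zero).congr_fun (fun t ht => ?_) measurableSet_Ioi
      have : 0 ≤ Real.log t := Real.log_nonneg (le_of_lt ht)
      simp [this]

/-- The logarithmic potential of the uniform measure on the unit disc. -/
def discPotential (w : E2) : ℝ := ∫ y, gfun (w - y) ∂(udisc 0 1)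

lemma neg_log_le_gfun {u : E2} {R : ℝ} (hR : 1 ≤ R) (hu : ‖u‖ ≤ R) : -Real.log R ≤ gfun u := by
  unfold gfun
  rcases (norm_nonneg u).eq_or_lt with h | h
  · simp [← h, Real.log_nonneg hR]
  · exact neg_le_neg (Real.log_le_log h hu)

lemma ae_neg_log_le_gfun_sub (w : E2) :
    ∀ᵐ y ∂(udisc 0 1), -Real.log (‖w‖ + 1) ≤ gfun (w - y) := by
  filter_upwards [ae_norm_le_one] with y hy
  exact neg_log_le_gfun (by linarith [norm_nonneg w]) ((norm_sub_le w y).trans (by linarith))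

lemma integrable_gfun_sub (w : E2) : Integrable (fun y => gfun (w - y)) (udisc 0 1) := by
  have hp := integrable_udisc_of_integrable (integrable_max_gfun_zero.comp_sub_left w)
  refine (hp.add (integrable_const (Real.log (‖w‖ + 1)))).mono'
    (measurable_gfun.comp (measurable_const_sub w)).aestronglyMeasurable ?_
  filter_upwards [ae_neg_log_le_gfun_sub w] with y hy
  have h0 : 0 ≤ Real.log (‖w‖ + 1) := Real.log_nonneg (by linarith [norm_nonneg w])
  have h1 := le_max_left (gfun (w - y)) 0
  have h2 := le_max_right (gfun (w - y)) 0
  rw [Real.norm_eq_abs, abs_le]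
  constructor <;> simp only [Pi.add_apply] <;> linarith

lemma measurable_discPotential : Measurable discPotential := by
  have : StronglyMeasurable (Function.uncurry fun w y : E2 => gfun (w - y)) :=
    (measurable_gfun.comp (measurable_fst.sub measurable_snd)).stronglyMeasurable
  exact this.integral_prod_right.measurable

lemma exists_discPotential_le : ∃ C : ℝ, ∀ w, discPotential w ≤ C := by
  refine ⟨((volume (Metric.closedBall (0 : E2) 1))⁻¹).toReal * ∫ x : E2, max (gfun x) 0,
    fun w => ?_⟩
  have hp := integrable_max_gfun_zero.comp_sub_left w
  calc discPotential w ≤ ∫ y, max (gfun (w - y)) 0 ∂(udisc 0 1) :=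
        integral_mono (integrable_gfun_sub w) (integrable_udisc_of_integrable hp)
          fun y => le_max_left _ _
    _ = ((volume (Metric.closedBall (0 : E2) 1))⁻¹).toReal *
          ∫ y in Metric.closedBall (0 : E2) 1, max (gfun (w - y)) 0 := by
        rw [udisc, integral_smul_measure, smul_eq_mul]
    _ ≤ ((volume (Metric.closedBall (0 : E2) 1))⁻¹).toReal * ∫ y : E2, max (gfun (w - y)) 0 :=
        mul_le_mul_of_nonneg_left
          (setIntegral_le_integral hp (ae_of_all _ fun y => le_max_right _ _))
          ENNReal.toReal_nonneg
    _ = _ := by rw [integral_sub_left_eq_self (fun x : E2 => max (gfun x) 0)]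

lemma neg_log_le_discPotential (w : E2) : -Real.log (‖w‖ + 1) ≤ discPotential w := by
  simpa [discPotential] using integral_mono_ae (integrable_const _) (integrable_gfun_sub w)
    (ae_neg_log_le_gfun_sub w)

lemma discPotential_le_neg_log {w : E2} {t : ℝ} (ht : 0 < t) (hw : t + 1 ≤ ‖w‖) :
    discPotential w ≤ -Real.log t := by
  have : ∀ᵐ y ∂(udisc 0 1), gfun (w - y) ≤ -Real.log t := by
    filter_upwards [ae_norm_le_one] with y hy
    refine neg_le_neg (Real.log_le_log ht ?_)
    linarith [norm_sub_norm_le w y]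
  simpa [discPotential] using integral_mono_ae (integrable_gfun_sub w) (integrable_const _) this

lemma integrable_discPotential_sub (v : E2) :
    Integrable (fun x => discPotential (x - v)) (udisc 0 1) := by
  obtain ⟨C, hC⟩ := exists_discPotential_le
  refine (integrable_const (|C| + Real.log (‖v‖ + 2))).mono'
    (measurable_discPotential.comp (measurable_sub_const v)).aestronglyMeasurable ?_
  filter_upwards [ae_norm_le_one] with x hx
  have h1 := neg_log_le_discPotential (x - v)
  have h2 : Real.log (‖x - v‖ + 1) ≤ Real.log (‖v‖ + 2) :=
    Real.log_le_log (by positivity) (by linarith [norm_sub_le x v])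
  have h3 : 0 ≤ Real.log (‖v‖ + 2) := Real.log_nonneg (by linarith [norm_nonneg v])
  rw [Real.norm_eq_abs, abs_le]
  constructor <;> linarith [hC (x - v), le_abs_self C, abs_nonneg C]

lemma gsm_eq_integral_sub_sub (r : ℝ) (z : E2) :
    gsm r z = ∫ x, ∫ y, gfun (x - y - z) ∂(udisc 0 r) ∂(udisc 0 r) := by
  unfold gsm
  congr! 2 with x
  rw [← map_add_right_udisc z r, (measurableEmbedding_addRight z).integral_map]
  simp [sub_sub]

lemma gsm_one_eq (v : E2) : gsm 1 v = ∫ x, discPotential (x - v) ∂(udisc 0 1) := by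
  simp only [gsm_eq_integral_sub_sub, discPotential, sub_right_comm _ _ v]

lemma measurable_gsm_one : Measurable (gsm 1) := by
  have : StronglyMeasurable (Function.uncurry fun v x : E2 => discPotential (x - v)) :=
    (measurable_discPotential.comp (measurable_snd.sub measurable_fst)).stronglyMeasurable
  rw [funext gsm_one_eq]
  exact this.integral_prod_right.measurable

lemma exists_gsm_one_le : ∃ C : ℝ, ∀ v, gsm 1 v ≤ C := by
  obtain ⟨C, hC⟩ := exists_discPotential_le
  refine ⟨C, fun v => ?_⟩
  rw [gsm_one_eq]
  simpa using integral_mono (integrable_discPotential_sub v) (integrable_const C)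
    fun x => hC (x - v)

lemma gsm_one_le_neg_log {v : E2} {t : ℝ} (ht : 0 < t) (hv : t + 2 ≤ ‖v‖) :
    gsm 1 v ≤ -Real.log t := by
  have : ∀ᵐ x ∂(udisc 0 1), discPotential (x - v) ≤ -Real.log t := by
    filter_upwards [ae_norm_le_one] with x hx
    refine discPotential_le_neg_log ht ?_
    linarith [norm_sub_norm_le v x, norm_sub_rev v x]
  rw [gsm_one_eq]
  simpa using integral_mono_ae (integrable_discPotential_sub v) (integrable_const _) this

/-- The smeared interaction is invariant under linear isometries. -/
lemma gsm_map (A : E2 ≃ₗᵢ[ℝ] E2) (r : ℝ) (z : E2) : gsm r (A z) = gsm r z := by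
  have hA : MeasurableEmbedding A := A.toHomeomorph.measurableEmbedding
  have hsub (f : E2 → ℝ) : ∫ x, f x ∂(udisc 0 r) = ∫ x, f (A x) ∂(udisc 0 r) := by
    conv_lhs => rw [← map_linearIsometryEquiv_udisc A r, hA.integral_map]
  rw [gsm_eq_integral_sub_sub, gsm_eq_integral_sub_sub, hsub]
  congr! 2 with x
  rw [hsub]
  congr! 2 with y
  simp only [gfun, ← map_sub, A.norm_map]

lemma gsm_one_eq_g1rad_norm (u : E2) : gsm 1 u = g1rad ‖u‖ := by
  have h : ‖u‖ = ‖EuclideanSpace.single (0 : Fin 2) ‖u‖‖ := by simp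
  rw [g1rad, ← Submodule.reflection_sub h, gsm_map]

/-- Scaling of the smeared interaction. -/
lemma gsm_smul {r : ℝ} (hr : 0 < r) (v : E2) : gsm r (r • v) = -Real.log r + gsm 1 v := by
  have he : MeasurableEmbedding (fun x : E2 => r • x) := measurableEmbedding_const_smul₀ hr.ne'
  have hsub (f : E2 → ℝ) : ∫ x, f x ∂(udisc 0 r) = ∫ x, f (r • x) ∂(udisc 0 1) := by
    rw [← map_smul_udisc hr, he.integral_map]
  have hinner (x : E2) : ∫ y, gfun (r • x - r • y - r • v) ∂(udisc 0 1)
      = -Real.log r + discPotential (x - v) := by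
    have hne : ∀ᵐ y ∂(udisc 0 1), y ≠ x - v :=
      (udisc_absolutelyContinuous 0 1).ae_le (Measure.ae_ne volume (x - v))
    calc _ = ∫ y, (-Real.log r + gfun (x - v - y)) ∂(udisc 0 1) := by
          refine integral_congr_ae ?_
          filter_upwards [hne] with y hy
          have h0 : ‖x - v - y‖ ≠ 0 := norm_ne_zero_iff.2 (sub_ne_zero.2 hy.symm)
          rw [← smul_sub, ← smul_sub, sub_right_comm, gfun, gfun, norm_smul, Real.norm_eq_abs,
            abs_of_pos hr, Real.log_mul hr.ne' h0]
          ring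
      _ = _ := by
          rw [integral_add (integrable_const _) (integrable_gfun_sub _)]
          simp [discPotential]
  rw [gsm_eq_integral_sub_sub, hsub]
  simp_rw [hsub, hinner]
  rw [integral_add (integrable_const _) (integrable_discPotential_sub v), gsm_one_eq]
  simp

lemma measurable_g1rad : Measurable g1rad := by
  refine measurable_gsm_one.comp (Continuous.measurable ?_)
  exact (PiLp.continuous_toLp 2 _).comp (continuous_single (A := fun _ : Fin 2 => ℝ) 0)

lemma integrableOn_exp_g1rad {β : ℝ} (hβ : 2 < β) :
    IntegrableOn (fun r : ℝ => Real.exp (β * g1rad r) * r) (Set.Ioi 0) := by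
  have hmeas : Measurable fun r : ℝ => Real.exp (β * g1rad r) * r :=
    ((measurable_g1rad.const_mul β).exp).mul measurable_id
  obtain ⟨C, hC⟩ := exists_gsm_one_le
  rw [← Set.Ioc_union_Ioi_eq_Ioi (show (0 : ℝ) ≤ 4 by norm_num)]
  refine IntegrableOn.union ?_ ?_
  · refine Measure.integrableOn_of_bounded (M := Real.exp (β * C) * 4) (by simp)
      hmeas.aestronglyMeasurable ?_
    filter_upwards [ae_restrict_mem measurableSet_Ioc] with r hr
    rw [Real.norm_of_nonneg (mul_nonneg (Real.exp_pos _).le hr.1.le)]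
    have : g1rad r ≤ C := hC _
    gcongr
    · exact hr.1.le
    · exact hr.2
  · have hint : IntegrableOn (fun r : ℝ => 2 ^ β * r ^ (1 - β)) (Set.Ioi 4) :=
      (integrableOn_Ioi_rpow_of_lt (by linarith) (by norm_num)).const_mul _
    refine hint.mono' hmeas.aestronglyMeasurable ?_
    filter_upwards [ae_restrict_mem measurableSet_Ioi] with r hr
    have hr4 : 4 < r := hr
    have hr0 : 0 < r := by linarith
    have hg : g1rad r ≤ -Real.log (r / 2) := by
      refine gsm_one_le_neg_log (by linarith) ?_
      simp only [PiLp.norm_single, Real.norm_of_nonneg hr0.le]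
      linarith
    rw [Real.norm_of_nonneg (mul_nonneg (Real.exp_pos _).le hr0.le)]
    calc Real.exp (β * g1rad r) * r ≤ Real.exp (β * -Real.log (r / 2)) * r := by gcongr
      _ = 2 ^ β * r ^ (1 - β) := by
        rw [Real.log_div hr0.ne' two_ne_zero, Real.rpow_def_of_pos two_pos,
          Real.rpow_def_of_pos hr0, ← Real.exp_add]
        nth_rw 2 [← Real.exp_log hr0]
        rw [← Real.exp_add]
        ring_nf

lemma Zbeta_eq {β : ℝ} (hβ : 2 < β) :
    Zbeta β = 2 * Real.pi * ∫ r in Set.Ioi (0 : ℝ), Real.exp (β * g1rad r) * r :=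
  if_neg hβ.ne'

lemma Zbeta_pos {β : ℝ} (hβ : 2 < β) : 0 < Zbeta β := by
  rw [Zbeta_eq hβ]
  refine mul_pos Real.two_pi_pos ?_
  rw [setIntegral_pos_iff_support_of_nonneg_ae _ (integrableOn_exp_g1rad hβ)]
  · have : Set.Ioi (0 : ℝ) ⊆
        Function.support (fun r : ℝ => Real.exp (β * g1rad r) * r) ∩ Set.Ioi 0 :=
      fun r hr => ⟨(mul_pos (Real.exp_pos _) hr).ne', hr⟩
    exact lt_of_lt_of_le (by simp) (measure_mono this)
  · filter_upwards [ae_restrict_mem measurableSet_Ioi] with r hr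
    exact (mul_pos (Real.exp_pos _) hr).le

lemma integral_exp_gsm_one {β : ℝ} (hβ : 2 < β) :
    ∫ u : E2, Real.exp (β * gsm 1 u) = Zbeta β := by
  have hball : (volume : Measure E2).real (Metric.ball 0 1) = Real.pi := by
    simp [Measure.real, EuclideanSpace.volume_ball_fin_two, Real.pi_pos.le]
  simp_rw [gsm_one_eq_g1rad_norm]
  rw [integral_fun_norm_addHaar volume (fun r => Real.exp (β * g1rad r)), hball,
    finrank_euclideanSpace_fin, Zbeta_eq hβ]
  simp [mul_comm, mul_left_comm, mul_assoc]

/-- For `β > 2`, `𝒵_β` is finite and positive, and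
`∫_{ℝ²} exp(β g_lam(u)) du = lam^{2-β} 𝒵_β` (equation (3.20)). -/
theorem statement17 (β : ℝ) (hβ : 2 < β) :
    MeasureTheory.IntegrableOn (fun r : ℝ => Real.exp (β * g1rad r) * r)
        (Set.Ioi (0 : ℝ)) ∧
      0 < Zbeta β ∧
      ∀ lam : ℝ, 0 < lam →
        (∫ u : E2, Real.exp (β * gsm lam u)) = lam ^ (2 - β) * Zbeta β := by
  refine ⟨integrableOn_exp_g1rad hβ, Zbeta_pos hβ, fun lam hlam => ?_⟩
  have h := Measure.integral_comp_smul volume (fun u : E2 => Real.exp (β * gsm lam u)) lam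
  simp_rw [gsm_smul hlam, mul_add, Real.exp_add] at h
  rw [integral_const_mul, integral_exp_gsm_one hβ, finrank_euclideanSpace_fin, smul_eq_mul,
    abs_of_pos (by positivity), inv_mul_eq_div, eq_div_iff (by positivity)] at h
  rw [← h, Real.rpow_sub hlam, Real.rpow_def_of_pos hlam β, div_eq_mul_inv, ← Real.exp_neg,
    Real.rpow_two]
  ring_nf
end
end

section
/- Let N ≥ 1, λ > 0, and x_1,…,x_N, y_1,…,y_N ∈ ℝ². Define h_λ : ℝ² → ℝ by h_λ(x) = Σ_{i=1}^N ( ∫ g(x−w) dδ_{x_i}^{(λ)}(w) − ∫ g(x−w) dδ_{y_i}^{(λ)}(w) ). Then h_λ is continuously differentiable on ℝ², its gradient ∇h_λ is square-integrable on ℝ², and F_λ(X_N,Y_N) = (1/4π) ∫_{ℝ²} |∇h_λ|² dx − N ( g(λ) + κ ). -/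
open MeasureTheory Real
open scoped ENNReal NNReal BigOperators Classical

noncomputable section

/-- The electric potential `h_lam` generated by the configuration `(X_N, Y_N)`. -/
def hpot (N : ℕ) (lam : ℝ) (X Y : Fin N → E2) (x : E2) : ℝ :=
  ∑ i : Fin N,
    ((∫ w, gfun (x - w) ∂(udisc (X i) lam)) - ∫ w, gfun (x - w) ∂(udisc (Y i) lam))

/-- The potential of the uniform measure on the disc of radius `lam` centred at the origin, as a
function of the squared distance to the origin. -/
def discProfile (lam t : ℝ) : ℝ :=
  -Real.log lam - ∫ s in lam ^ 2..t, (2 * max s (lam ^ 2))⁻¹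

/-- The opposite of the electric field of the uniform measure on the disc of radius `lam`. -/
def discField (lam : ℝ) (x : E2) : E2 := (max ‖x‖ lam ^ 2)⁻¹ • x

lemma max_sq_sq {a b : ℝ} (ha : 0 ≤ a) (hb : 0 ≤ b) : max (a ^ 2) (b ^ 2) = max a b ^ 2 := by
  rcases le_total a b with h | h
  · rw [max_eq_right h, max_eq_right (pow_le_pow_left₀ ha h 2)]
  · rw [max_eq_left h, max_eq_left (pow_le_pow_left₀ hb h 2)]

lemma hasDerivAt_discProfile {lam : ℝ} (hlam : 0 < lam) (t : ℝ) :
    HasDerivAt (discProfile lam) (-(2 * max t (lam ^ 2))⁻¹) t := by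
  have hc : Continuous fun s : ℝ => (2 * max s (lam ^ 2))⁻¹ := by
    refine Continuous.inv₀ (by fun_prop) fun s => ?_
    have : 0 < max s (lam ^ 2) := lt_max_of_lt_right (by positivity)
    positivity
  exact (intervalIntegral.integral_hasDerivAt_right (hc.intervalIntegrable _ _)
    (hc.stronglyMeasurableAtFilter _ _) hc.continuousAt).const_sub _

lemma hasGradientAt_discProfile {lam : ℝ} (hlam : 0 < lam) (x : E2) :
    HasGradientAt (fun x : E2 => discProfile lam (‖x‖ ^ 2)) (-discField lam x) x := by
  have h := (hasDerivAt_discProfile hlam (‖x‖ ^ 2)).comp_hasFDerivAt x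
    (hasStrictFDerivAt_norm_sq x).hasFDerivAt
  rw [hasGradientAt_iff_hasFDerivAt]
  refine h.congr_fderiv ?_
  ext v
  simp [discField, max_sq_sq (norm_nonneg x) hlam.le]
  ring

lemma hasGradientAt_discProfile_sub {lam : ℝ} (hlam : 0 < lam) (a x : E2) :
    HasGradientAt (fun x : E2 => discProfile lam (‖x - a‖ ^ 2)) (-discField lam (x - a)) x := by
  have h := hasGradientAt_discProfile hlam (x - a)
  rw [hasGradientAt_iff_hasFDerivAt] at h ⊢
  exact h.comp x ((hasFDerivAt_id x).sub_const a)

lemma norm_discField_sub_le {lam : ℝ} (hlam : 0 < lam) (x y : E2) :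
    ‖discField lam x - discField lam y‖ ≤
      (2 * (max ‖y‖ lam)⁻¹ ^ 2 + (max ‖x‖ lam)⁻¹ * (max ‖y‖ lam)⁻¹) * ‖x - y‖ := by
  have hp : 0 < max ‖x‖ lam := lt_max_of_lt_right hlam
  have hq : 0 < max ‖y‖ lam := lt_max_of_lt_right hlam
  have hpx : ‖x‖ ≤ max ‖x‖ lam := le_max_left _ _
  have hpq : |max ‖y‖ lam - max ‖x‖ lam| ≤ ‖x - y‖ := by
    refine (abs_max_sub_max_le_abs _ _ _).trans ?_
    rw [norm_sub_rev]
    exact abs_norm_sub_norm_le y x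
  unfold discField
  generalize max ‖x‖ lam = p at *
  generalize max ‖y‖ lam = q at *
  have e : (p ^ 2)⁻¹ • x - (q ^ 2)⁻¹ • y
      = (q ^ 2)⁻¹ • (x - y) + ((p ^ 2)⁻¹ * (q ^ 2)⁻¹ * ((q - p) * (q + p))) • x := by
    rw [smul_sub, sub_add_eq_add_sub, ← add_smul]
    congr 2
    field_simp
    ring
  rw [e]
  refine (norm_add_le _ _).trans ?_
  rw [norm_smul, norm_smul, Real.norm_eq_abs, Real.norm_eq_abs, abs_of_pos (by positivity),
    abs_mul, abs_of_pos (by positivity : 0 < (p ^ 2)⁻¹ * (q ^ 2)⁻¹), abs_mul,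
    abs_of_pos (by positivity : 0 < q + p)]
  calc _ ≤ (q ^ 2)⁻¹ * ‖x - y‖ + (p ^ 2)⁻¹ * (q ^ 2)⁻¹ * (‖x - y‖ * (q + p)) * p := by gcongr
    _ = _ := by field_simp; ring

lemma lipschitzWith_discField {lam : ℝ} (hlam : 0 < lam) :
    LipschitzWith (Real.toNNReal (3 * lam⁻¹ ^ 2)) (discField lam) := by
  refine LipschitzWith.of_dist_le_mul fun x y => ?_
  rw [dist_eq_norm, dist_eq_norm, Real.coe_toNNReal _ (by positivity)]
  refine (norm_discField_sub_le hlam x y).trans ?_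
  have hx : (max ‖x‖ lam)⁻¹ ≤ lam⁻¹ := inv_anti₀ hlam (le_max_right _ _)
  have hy : (max ‖y‖ lam)⁻¹ ≤ lam⁻¹ := inv_anti₀ hlam (le_max_right _ _)
  have hx0 : 0 ≤ (max ‖x‖ lam)⁻¹ := by positivity
  have hy0 : 0 ≤ (max ‖y‖ lam)⁻¹ := by positivity
  gcongr
  nlinarith [mul_le_mul hx hy hy0 (by positivity), mul_le_mul hy hy hy0 (by positivity)]

lemma norm_discField_le {lam : ℝ} (hlam : 0 < lam) (x : E2) : ‖discField lam x‖ ≤ lam⁻¹ := by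
  have hp : 0 < max ‖x‖ lam := lt_max_of_lt_right hlam
  rw [discField, norm_smul, norm_inv, norm_pow, Real.norm_of_nonneg hp.le]
  calc _ ≤ (max ‖x‖ lam ^ 2)⁻¹ * max ‖x‖ lam := by gcongr; exact le_max_left _ _
    _ = (max ‖x‖ lam)⁻¹ := by field_simp
    _ ≤ lam⁻¹ := inv_anti₀ hlam (le_max_right _ _)

lemma one_add_norm_le_mul_max {lam : ℝ} (hlam : 0 < lam) (a x : E2) :
    1 + ‖x‖ ≤ ((1 + ‖a‖) / lam + 1) * max ‖x - a‖ lam := by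
  have h1 : ‖x‖ ≤ ‖x - a‖ + ‖a‖ := by simpa using norm_add_le (x - a) a
  have h2 : 1 + ‖a‖ ≤ (1 + ‖a‖) / lam * max ‖x - a‖ lam := by
    rw [div_mul_eq_mul_div, le_div_iff₀ hlam]
    gcongr
    exact le_max_right _ _
  linarith [le_max_left ‖x - a‖ lam]

lemma exists_norm_discField_sub_discField_le {lam : ℝ} (hlam : 0 < lam) (a b : E2) :
    ∃ C, ∀ x, ‖discField lam (x - a) - discField lam (x - b)‖ ≤ C * (1 + ‖x‖)⁻¹ ^ 2 := by
  have key (a x : E2) :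
      (max ‖x - a‖ lam)⁻¹ ≤ ((1 + ‖a‖) / lam + 1) * (1 + ‖x‖)⁻¹ := by
    have hp : 0 < max ‖x - a‖ lam := lt_max_of_lt_right hlam
    rw [← div_eq_mul_inv, le_div_iff₀ (by positivity), inv_mul_le_iff₀ hp, mul_comm]
    exact one_add_norm_le_mul_max hlam a x
  set A := (1 + ‖a‖) / lam + 1
  set B := (1 + ‖b‖) / lam + 1
  have hA0 : 0 ≤ A := by positivity
  have hB0 : 0 ≤ B := by positivity
  refine ⟨(2 * B ^ 2 + A * B) * ‖b - a‖, fun x => ?_⟩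
  refine (norm_discField_sub_le hlam (x - a) (x - b)).trans ?_
  rw [sub_sub_sub_cancel_left]
  have h1 : 0 ≤ (max ‖x - a‖ lam)⁻¹ := by positivity
  have h2 : 0 ≤ (max ‖x - b‖ lam)⁻¹ := by positivity
  calc _ ≤ (2 * (B * (1 + ‖x‖)⁻¹) ^ 2 + (A * (1 + ‖x‖)⁻¹) * (B * (1 + ‖x‖)⁻¹)) * ‖b - a‖ := by
        gcongr
        exacts [key b x, key a x, key b x]
    _ = _ := by ring

lemma abs_discProfile_sub_le {lam : ℝ} (hlam : 0 < lam) (a b : E2) :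
    ∀ x : E2, |discProfile lam (‖x - a‖ ^ 2) - discProfile lam (‖x - b‖ ^ 2)| ≤
      lam⁻¹ * ‖b - a‖ := by
  intro x
  have := Convex.norm_image_sub_le_of_norm_hasFDerivWithin_le (𝕜 := ℝ)
    (f := fun x : E2 => discProfile lam (‖x‖ ^ 2)) (s := Set.univ) (C := lam⁻¹)
    (x := x - b) (y := x - a)
    (fun y _ => (hasGradientAt_discProfile hlam y).hasFDerivAt.hasFDerivWithinAt)
    (fun y _ => by simpa using norm_discField_le hlam y) convex_univ trivial trivial
  simpa using this

/-- The electric field is divergence free outside of the disc, and its divergence is constant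
inside. -/
lemma sum_lineDeriv_discField {lam : ℝ} (hlam : 0 < lam) (x : E2) (hx : ‖x‖ ≠ lam) :
    ∑ k : Fin 2, lineDeriv ℝ (fun y => discField lam y k) x (EuclideanSpace.single k 1) =
      (Metric.closedBall (0 : E2) lam).indicator (fun _ => 2 * (lam ^ 2)⁻¹) x := by
  rcases lt_or_gt_of_ne hx with h | h
  · rw [Set.indicator_of_mem (by simpa using h.le)]
    have hd (k : Fin 2) : HasFDerivAt (fun y : E2 => discField lam y k)
        ((lam ^ 2)⁻¹ • (EuclideanSpace.proj k : E2 →L[ℝ] ℝ)) x := by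
      refine HasFDerivAt.congr_of_eventuallyEq
        ((EuclideanSpace.proj k : E2 →L[ℝ] ℝ).hasFDerivAt.const_smul ((lam ^ 2)⁻¹)) ?_
      filter_upwards [continuous_norm.continuousAt.eventually_lt_const h] with y hy
      simp [discField, max_eq_right hy.le]
    simp [(hd _).hasLineDerivAt _ |>.lineDeriv]
  · rw [Set.indicator_of_notMem (by simpa using h)]
    have hx0 : 0 < ‖x‖ := hlam.trans h
    have hd (k : Fin 2) : HasFDerivAt (fun y : E2 => discField lam y k)
        ((‖x‖ ^ 2)⁻¹ • (EuclideanSpace.proj k : E2 →L[ℝ] ℝ)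
          + x k • (-((‖x‖ ^ 2) ^ 2)⁻¹ • (2 • innerSL ℝ x))) x := by
      refine HasFDerivAt.congr_of_eventuallyEq
        ((((hasDerivAt_inv (by positivity : ‖x‖ ^ 2 ≠ 0)).comp_hasFDerivAt x
          (hasStrictFDerivAt_norm_sq x).hasFDerivAt)).mul
          (EuclideanSpace.proj k : E2 →L[ℝ] ℝ).hasFDerivAt) ?_
      filter_upwards [continuous_norm.continuousAt.eventually_const_lt h] with y hy
      simp [discField, max_eq_left hy.le]
    have hn := EuclideanSpace.real_norm_sq_eq x
    simp only [Fin.sum_univ_two] at hn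
    simp [(hd _).hasLineDerivAt _ |>.lineDeriv, PiLp.inner_apply]
    field_simp
    rw [hn]
    ring

lemma integral_udisc {lam : ℝ} (hlam : 0 < lam) (a : E2) (f : E2 → ℝ) :
    ∫ x, f x ∂(udisc a lam) =
      (π * lam ^ 2)⁻¹ * ∫ x, (Metric.closedBall a lam).indicator f x := by
  rw [udisc, integral_smul_measure, integral_indicator Metric.isClosed_closedBall.measurableSet,
    EuclideanSpace.volume_closedBall_fin_two, smul_eq_mul, ENNReal.toReal_inv]
  simp [hlam.le, pi_nonneg, mul_comm]

lemma integral_udisc_eq_integral_add {lam : ℝ} (hlam : 0 < lam) (a : E2) (f : E2 → ℝ) :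
    ∫ x, f x ∂(udisc a lam) = ∫ x, f (x + a) ∂(udisc 0 lam) := by
  rw [integral_udisc hlam, integral_udisc hlam, ← integral_add_right_eq_self _ a]
  congr 2 with x
  simp [Set.indicator]

lemma integral_udisc_zero_comp_neg {lam : ℝ} (hlam : 0 < lam) (f : E2 → ℝ) :
    ∫ x, f (-x) ∂(udisc 0 lam) = ∫ x, f x ∂(udisc 0 lam) := by
  rw [integral_udisc hlam, integral_udisc hlam, ← integral_neg_eq_self]
  congr 2 with x
  simp [Set.indicator]

lemma integrableOn_log_norm_closedBall (c : ℂ) (R : ℝ) :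
    IntegrableOn (fun z : ℂ => Real.log ‖z - c‖) (Metric.closedBall 0 R) := by
  have h0 : IntegrableOn (fun z : ℂ => Real.log ‖z‖) (Metric.closedBall 0 (|R| + ‖c‖)) := by
    rw [← integrable_indicator_iff Metric.isClosed_closedBall.measurableSet]
    have : (Metric.closedBall (0 : ℂ) (|R| + ‖c‖)).indicator (fun z : ℂ => Real.log ‖z‖)
        = fun z => (Set.Iic (|R| + ‖c‖)).indicator Real.log ‖z‖ := by
      ext z; simp [Set.indicator]
    rw [this, integrable_fun_norm_addHaar]
    have h1 : IntegrableOn (fun y : ℝ => y * Real.log y) (Set.Icc 0 (|R| + ‖c‖)) :=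
      Real.continuous_mul_log.continuousOn.integrableOn_Icc
    rw [← integrable_indicator_iff measurableSet_Ioi]
    refine ((integrable_indicator_iff measurableSet_Icc).2 h1).mono
      (((measurable_id.pow_const _).smul
        (Real.measurable_log.indicator measurableSet_Iic)).indicator
          measurableSet_Ioi).aestronglyMeasurable (ae_of_all _ fun y => ?_)
    rcases le_or_gt y 0 with hy | hy
    · simp [hy]
    · simp only [Set.indicator, Set.mem_Ioi, Set.mem_Icc, Set.mem_Iic, hy, hy.le, if_true, true_and]
      split_ifs <;> simp
  have h1 := (measurePreserving_sub_right (volume : Measure ℂ) c).integrableOn_comp_preimage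
    (measurableEmbedding_subRight c) |>.2 h0
  refine h1.mono_set fun z hz => ?_
  simp only [Metric.mem_closedBall, dist_zero_right, Set.mem_preimage] at hz ⊢
  exact (norm_sub_le _ _).trans (by gcongr; exact hz.trans (le_abs_self _))

lemma integral_comp_circleMap (f : ℂ → ℝ) (r : ℝ) :
    ∫ θ in Set.Ioo (-π) π, f (Complex.polarCoord.symm (r, θ)) =
      2 * π * Real.circleAverage f 0 r := by
  rw [← integral_Ioc_eq_integral_Ioo, ← intervalIntegral.integral_of_le (by linarith [pi_pos]),
    Real.circleAverage_def, smul_eq_mul, mul_inv_cancel_left₀ (by positivity)]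
  have hp : Function.Periodic (fun θ => f (circleMap 0 r θ)) (2 * π) :=
    (periodic_circleMap 0 r).comp f
  have := hp.intervalIntegral_add_eq (-π) 0
  rw [zero_add, show -π + 2 * π = π by ring] at this
  rw [← this]
  refine intervalIntegral.integral_congr fun θ _ => ?_
  simp [circleMap, Complex.exp_mul_I]

lemma integral_closedBall_eq_integral_circleAverage {f : ℂ → ℝ} {R : ℝ} (hfm : Measurable f)
    (hf : IntegrableOn f (Metric.closedBall 0 R)) (hR : 0 ≤ R) :
    ∫ z in Metric.closedBall 0 R, f z =
      ∫ r in 0..R, r * (2 * π * Real.circleAverage f 0 r) := by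
  set F := (Metric.closedBall (0 : ℂ) R).indicator f with hF
  have hFm : Measurable F := hfm.indicator Metric.isClosed_closedBall.measurableSet
  have hFi : Integrable F := hf.integrable_indicator Metric.isClosed_closedBall.measurableSet
  have hs : Measurable fun p : ℝ × ℝ => Complex.polarCoord.symm p := by
    simp only [Complex.polarCoord_symm_apply]
    fun_prop
  have hint : IntegrableOn (fun p : ℝ × ℝ => p.1 • F (Complex.polarCoord.symm p))
      polarCoord.target := by
    refine ⟨(measurable_fst.smul (hFm.comp hs)).aestronglyMeasurable, ?_⟩
    have h2 := Complex.lintegral_comp_polarCoord_symm fun z => ‖F z‖ₑ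
    have h3 := hFi.2
    rw [HasFiniteIntegral, ← h2] at h3
    rw [HasFiniteIntegral]
    refine (lintegral_mono_ae ?_).trans_lt h3
    filter_upwards [self_mem_ae_restrict polarCoord.open_target.measurableSet] with p hp
    have hp1 : 0 < p.1 := by simpa using hp.1
    rw [enorm_smul, smul_eq_mul, Real.enorm_of_nonneg hp1.le]
  rw [← integral_indicator Metric.isClosed_closedBall.measurableSet, ← hF,
    ← Complex.integral_comp_polarCoord_symm]
  rw [polarCoord_target] at hint ⊢
  rw [Measure.volume_eq_prod] at hint ⊢
  rw [setIntegral_prod _ hint]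
  have h4 : ∀ r ∈ Set.Ioi (0 : ℝ),
      (∫ θ in Set.Ioo (-π) π, (r, θ).1 • F (Complex.polarCoord.symm (r, θ))) =
        (Set.Ioc 0 R).indicator (fun r => r * (2 * π * Real.circleAverage f 0 r)) r := by
    intro r hr
    have hr : 0 < r := hr
    by_cases h : r ≤ R
    · rw [Set.indicator_of_mem (Set.mem_Ioc.2 ⟨hr, h⟩), ← integral_comp_circleMap,
        ← integral_const_mul]
      congr 1 with θ
      rw [hF, Set.indicator_of_mem]
      · rfl
      · simpa [Complex.norm_polarCoord_symm, abs_of_pos hr, -Complex.polarCoord_symm_apply] using h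
    · rw [Set.indicator_of_notMem (by simp [h])]
      refine integral_eq_zero_of_ae (ae_of_all _ fun θ => ?_)
      dsimp only
      rw [hF, Set.indicator_of_notMem]
      · simp
      · simpa [Complex.norm_polarCoord_symm, abs_of_pos hr, -Complex.polarCoord_symm_apply] using h
  rw [setIntegral_congr_fun measurableSet_Ioi h4, setIntegral_indicator measurableSet_Ioc,
    Set.inter_eq_right.2 Set.Ioc_subset_Ioi_self, intervalIntegral.integral_of_le hR]

lemma circleAverage_log_norm_sub {r : ℝ} (hr : 0 < r) (c : ℂ) :
    Real.circleAverage (fun z => Real.log ‖z - c‖) 0 r = Real.log (max r ‖c‖) := by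
  rw [circleAverage_log_norm_sub_const_eq_log_radius_add_posLog hr.ne', zero_sub, norm_neg]
  rcases le_total ‖c‖ r with h | h
  · rw [max_eq_left h, Real.posLog_eq_zero_iff _ |>.2, add_zero]
    rw [abs_of_nonneg (by positivity), inv_mul_le_iff₀ hr]
    simpa using h
  · have hc : 0 < ‖c‖ := hr.trans_le h
    rw [max_eq_right h, Real.posLog_eq_log, Real.log_mul (by positivity) hc.ne', Real.log_inv]
    · ring
    · rw [abs_of_nonneg (by positivity), le_inv_mul_iff₀ hr]
      simpa using h

lemma integral_mul_log (a b : ℝ) :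
    ∫ r in a..b, r * Real.log r =
      (b ^ 2 * Real.log b / 2 - b ^ 2 / 4) - (a ^ 2 * Real.log a / 2 - a ^ 2 / 4) := by
  have hc : Continuous fun r : ℝ => r ^ 2 * Real.log r / 2 - r ^ 2 / 4 := by
    have : (fun r : ℝ => r ^ 2 * Real.log r / 2 - r ^ 2 / 4) =
        fun r : ℝ => r * (r * Real.log r) / 2 - r ^ 2 / 4 := by ext; ring
    rw [this]
    have := Real.continuous_mul_log
    fun_prop
  refine integral_eq_of_hasDerivAt_off_countable _ _ (s := {0}) (Set.countable_singleton 0)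
    hc.continuousOn (fun r hr => ?_) (Real.continuous_mul_log.intervalIntegrable _ _)
  have hr0 : r ≠ 0 := by simpa using hr.2
  have := ((((hasDerivAt_id r).pow 2).mul (Real.hasDerivAt_log hr0)).div_const 2).sub
    (((hasDerivAt_id r).pow 2).div_const 4)
  convert! this using 1
  simp
  field_simp
  ring

lemma integral_mul_log_max {R s : ℝ} (hR : 0 < R) (hs : 0 ≤ s) :
    ∫ r in 0..R, r * Real.log (max r s) = -(R ^ 2 / 2) * discProfile R (s ^ 2) := by
  have hlog : ∀ r t : ℝ, ∫ r in r..t, r * Real.log s = (t ^ 2 - r ^ 2) / 2 * Real.log s := by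
    intro r t
    rw [intervalIntegral.integral_mul_const, integral_id]
  rcases le_total R s with h | h
  · have h1 : ∫ r in 0..R, r * Real.log (max r s) = ∫ r in 0..R, r * Real.log s := by
      refine intervalIntegral.integral_congr fun r hr => ?_
      rw [Set.uIcc_of_le hR.le] at hr
      simp only [max_eq_right (hr.2.trans h)]
    have h2 : ∫ t in R ^ 2..s ^ 2, (2 * max t (R ^ 2))⁻¹ = Real.log s - Real.log R := by
      have hle : R ^ 2 ≤ s ^ 2 := by gcongr
      have hs0 : 0 < s := hR.trans_le h
      have : ∫ t in R ^ 2..s ^ 2, (2 * max t (R ^ 2))⁻¹ = ∫ t in R ^ 2..s ^ 2, 2⁻¹ * t⁻¹ := by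
        refine intervalIntegral.integral_congr fun t ht => ?_
        rw [Set.uIcc_of_le hle] at ht
        simp only [max_eq_left ht.1, mul_inv]
      rw [this, intervalIntegral.integral_const_mul, integral_inv_of_pos (by positivity)
        (by positivity), Real.log_div (by positivity) (by positivity), Real.log_pow, Real.log_pow]
      push_cast
      ring
    rw [h1, hlog, discProfile, h2]
    ring
  · have h1 : ∫ r in 0..s, r * Real.log (max r s) = ∫ r in 0..s, r * Real.log s := by
      refine intervalIntegral.integral_congr fun r hr => ?_
      rw [Set.uIcc_of_le hs] at hr
      simp only [max_eq_right hr.2]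
    have h1' : ∫ r in s..R, r * Real.log (max r s) = ∫ r in s..R, r * Real.log r := by
      refine intervalIntegral.integral_congr fun r hr => ?_
      rw [Set.uIcc_of_le h] at hr
      simp only [max_eq_left hr.1]
    have h2 : ∫ t in R ^ 2..s ^ 2, (2 * max t (R ^ 2))⁻¹ = (s ^ 2 - R ^ 2) * (2 * R ^ 2)⁻¹ := by
      have hle : s ^ 2 ≤ R ^ 2 := by gcongr
      have : ∫ t in R ^ 2..s ^ 2, (2 * max t (R ^ 2))⁻¹ = ∫ t in R ^ 2..s ^ 2, (2 * R ^ 2)⁻¹ := by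
        refine intervalIntegral.integral_congr fun t ht => ?_
        rw [Set.uIcc_of_ge hle] at ht
        simp only [max_eq_right ht.2]
      rw [this, intervalIntegral.integral_const, smul_eq_mul]
    have hi1 : IntervalIntegrable (fun r => r * Real.log (max r s)) volume 0 s := by
      refine (Continuous.intervalIntegrable (u := fun r : ℝ => r * Real.log s)
        (by fun_prop) _ _).congr fun r hr => ?_
      rw [Set.uIoc_of_le hs] at hr
      simp only [max_eq_right hr.2]
    have hi2 : IntervalIntegrable (fun r => r * Real.log (max r s)) volume s R := by
      refine (Real.continuous_mul_log.intervalIntegrable _ _).congr fun r hr => ?_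
      rw [Set.uIoc_of_le h] at hr
      simp only [max_eq_left hr.1.le]
    rw [← intervalIntegral.integral_add_adjacent_intervals hi1 hi2, h1, h1', hlog,
      integral_mul_log, discProfile, h2]
    field_simp
    ring

lemma setIntegral_log_norm_sub {R : ℝ} (hR : 0 < R) (c : ℂ) :
    ∫ z in Metric.closedBall 0 R, Real.log ‖z - c‖ =
      -(π * R ^ 2) * discProfile R (‖c‖ ^ 2) := by
  rw [integral_closedBall_eq_integral_circleAverage (by fun_prop)
    (integrableOn_log_norm_closedBall c R) hR.le]
  have : ∫ r in 0..R, r * (2 * π * Real.circleAverage (fun z => Real.log ‖z - c‖) 0 r) =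
      ∫ r in 0..R, 2 * π * (r * Real.log (max r ‖c‖)) := by
    refine intervalIntegral.integral_congr_ae (ae_of_all _ fun r hr => ?_)
    rw [Set.uIoc_of_le hR.le] at hr
    rw [circleAverage_log_norm_sub hr.1]
    ring
  rw [this, intervalIntegral.integral_const_mul, integral_mul_log_max hR (norm_nonneg c)]
  ring

/-- The potential of the uniform measure on a disc. -/
lemma integral_gfun_sub_udisc {lam : ℝ} (hlam : 0 < lam) (a x : E2) :
    ∫ w, gfun (x - w) ∂(udisc a lam) = discProfile lam (‖x - a‖ ^ 2) := by
  set e := Complex.orthonormalBasisOneI.repr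
  rw [integral_udisc_eq_integral_add hlam, integral_udisc hlam,
    ← (e.measurePreserving).integral_comp e.toHomeomorph.measurableEmbedding]
  have h (z : ℂ) : (Metric.closedBall (0 : E2) lam).indicator (fun w => gfun (x - (w + a))) (e z) =
      (Metric.closedBall (0 : ℂ) lam).indicator
        (fun z => -Real.log ‖z - e.symm (x - a)‖) z := by
    have : ‖x - (e z + a)‖ = ‖z - e.symm (x - a)‖ := by
      rw [← e.norm_map, map_sub, e.apply_symm_apply, ← norm_neg]
      congr 1
      abel
    simp [Set.indicator, gfun, this]
  simp only [h]
  rw [integral_indicator Metric.isClosed_closedBall.measurableSet, integral_neg,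
    setIntegral_log_norm_sub hlam, e.symm.norm_map]
  field_simp

lemma integrable_udisc {lam : ℝ} (hlam : 0 < lam) (a : E2) {f : E2 → ℝ} (hf : Continuous f) :
    Integrable f (udisc a lam) := by
  refine Integrable.smul_measure
    (hf.continuousOn.integrableOn_compact (isCompact_closedBall a lam)) ?_
  exact ENNReal.inv_ne_top.2 (Metric.measure_closedBall_pos _ _ hlam).ne'

lemma continuous_discProfile_sub {lam : ℝ} (hlam : 0 < lam) (a : E2) :
    Continuous fun x : E2 => discProfile lam (‖x - a‖ ^ 2) :=
  continuous_iff_continuousAt.2 fun x => (hasGradientAt_discProfile_sub hlam a x).continuousAt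

lemma gsm_eq {lam : ℝ} (hlam : 0 < lam) (z : E2) :
    gsm lam z = ∫ x, discProfile lam (‖x - z‖ ^ 2) ∂(udisc 0 lam) := by
  simp only [gsm, integral_gfun_sub_udisc hlam]

lemma gsm_neg {lam : ℝ} (hlam : 0 < lam) (z : E2) : gsm lam (-z) = gsm lam z := by
  rw [gsm_eq hlam, gsm_eq hlam, ← integral_udisc_zero_comp_neg hlam]
  congr 1 with x
  rw [← norm_neg]
  congr 3
  abel

lemma integral_discProfile_sub_udisc {lam : ℝ} (hlam : 0 < lam) (a b : E2) :
    ∫ x, discProfile lam (‖x - b‖ ^ 2) ∂(udisc a lam) = gsm lam (b - a) := by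
  rw [integral_udisc_eq_integral_add hlam, gsm_eq hlam]
  congr 1 with x
  congr 3
  abel

/-- Gauss' law, in weak form, for the uniform measure on a disc. -/
lemma integral_fderiv_discField {lam : ℝ} (hlam : 0 < lam) (a : E2) {g : E2 → ℝ}
    (hg : ContDiff ℝ 1 g) (hc : HasCompactSupport g) :
    ∫ x, fderiv ℝ g x (discField lam (x - a)) = -(2 * π) * ∫ x, g x ∂(udisc a lam) := by
  obtain ⟨D, hD⟩ := hg.lipschitzWith_of_hasCompactSupport hc one_ne_zero
  have hgi : Integrable g := hg.continuous.integrable_of_hasCompactSupport hc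
  have hgd : Differentiable ℝ g := hg.differentiable one_ne_zero
  set e : Fin 2 → E2 := fun k => EuclideanSpace.single k 1
  set f : Fin 2 → E2 → ℝ := fun k x => discField lam (x - a) k
  have hlip (k : Fin 2) : LipschitzWith (Real.toNNReal (3 * lam⁻¹ ^ 2)) (f k) := by
    refine LipschitzWith.of_dist_le_mul fun x y => ?_
    have h1 := (lipschitzWith_discField hlam).dist_le_mul (x - a) (y - a)
    rw [dist_sub_right] at h1
    refine le_trans ?_ h1
    rw [dist_eq_norm, dist_eq_norm]
    exact PiLp.norm_apply_le (discField lam (x - a) - discField lam (y - a)) k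
  have hi (k : Fin 2) : Integrable fun x => lineDeriv ℝ (f k) x (e k) * g x :=
    hgi.mul_of_top_right ((hlip k).memLp_lineDeriv (e k))
  have hcont : Continuous fun x => fderiv ℝ g x := hg.continuous_fderiv one_ne_zero
  have hi' (k : Fin 2) : Integrable fun x => fderiv ℝ g x (e k) * f k x :=
    Continuous.integrable_of_hasCompactSupport
      ((hcont.clm_apply continuous_const).mul (hlip k).continuous)
      ((hc.fderiv_apply (𝕜 := ℝ) (e k)).mul_right)
  have key (k : Fin 2) : ∫ x, fderiv ℝ g x (e k) * f k x =
      -∫ x, lineDeriv ℝ (f k) x (e k) * g x := by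
    rw [(hlip k).integral_lineDeriv_mul_eq hD hc, ← integral_neg]
    congr 1 with x
    rw [(hgd x).lineDeriv_eq_fderiv, map_neg]
    ring
  have hsum (x : E2) : fderiv ℝ g x (discField lam (x - a)) = ∑ k, fderiv ℝ g x (e k) * f k x := by
    conv_lhs => rw [← (EuclideanSpace.basisFun (Fin 2) ℝ).sum_repr (discField lam (x - a))]
    simp [e, f, mul_comm]
  simp only [hsum]
  rw [integral_finsetSum _ fun k _ => hi' k]
  simp only [key]
  rw [Finset.sum_neg_distrib, ← integral_finsetSum _ fun k _ => hi k, integral_udisc hlam,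
    ← integral_const_mul, ← integral_const_mul, ← integral_neg]
  refine integral_congr_ae ?_
  have hs : ∀ᵐ x : E2, x ∉ Metric.sphere a lam :=
    measure_eq_zero_iff_ae_notMem.1 (Measure.addHaar_sphere _ a lam)
  filter_upwards [hs] with x hx
  have h1 := sum_lineDeriv_discField hlam (x - a) (by simpa [dist_eq_norm] using hx)
  have h2 (k : Fin 2) : lineDeriv ℝ (f k) x (e k) =
      lineDeriv ℝ (fun y => discField lam y k) (x - a) (e k) := by
    simp only [lineDeriv, f, add_sub_right_comm]
  simp only [h2, ← Finset.sum_mul]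
  rw [h1]
  by_cases hx' : x ∈ Metric.closedBall a lam
  · rw [Set.indicator_of_mem (by simpa [dist_eq_norm] using hx'), Set.indicator_of_mem hx']
    field_simp
  · rw [Set.indicator_of_notMem (by simpa [dist_eq_norm] using hx'), Set.indicator_of_notMem hx']
    simp

lemma exists_cutoff :
    ∃ φ : ℕ → E2 → ℝ, (∀ n, ContDiff ℝ 1 (φ n)) ∧ (∀ n, HasCompactSupport (φ n)) ∧
      (∀ n x, |φ n x| ≤ 1) ∧ (∀ x, ∀ᶠ n in Filter.atTop, φ n x = 1) ∧
      ∃ K, 0 ≤ K ∧ ∀ (n : ℕ) (x : E2), ‖fderiv ℝ (φ n) x‖ ≤ K * (n + 1 + ‖x‖)⁻¹ := by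
  let χ : ContDiffBump (0 : E2) := ⟨1, 2, one_pos, one_lt_two⟩
  have hχ : ContDiff ℝ 1 χ := χ.contDiff
  have hn (n : ℕ) : (0 : ℝ) < n + 1 := by positivity
  refine ⟨fun n x => χ (((n : ℝ) + 1)⁻¹ • x), fun n => hχ.comp (by fun_prop),
    fun n => χ.hasCompactSupport.comp_smul (inv_ne_zero (hn n).ne'), fun n x => ?_, fun x => ?_, ?_⟩
  · rw [abs_of_nonneg χ.nonneg]
    exact χ.le_one
  · filter_upwards [Filter.eventually_ge_atTop ⌈‖x‖⌉₊] with n hx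
    refine χ.one_of_mem_closedBall ?_
    rw [mem_closedBall_zero_iff, norm_smul, norm_inv, Real.norm_of_nonneg (hn n).le,
      inv_mul_le_iff₀ (hn n)]
    have := Nat.ceil_le.1 hx
    change ‖x‖ ≤ (n + 1) * 1
    linarith
  · obtain ⟨K, hK⟩ := (χ.hasCompactSupport.fderiv (𝕜 := ℝ)).smul_left
      (f := fun x : E2 => 1 + ‖x‖) |>.exists_bound_of_continuous
      ((by fun_prop : Continuous fun x : E2 => 1 + ‖x‖).smul (hχ.continuous_fderiv one_ne_zero))
    refine ⟨K, (norm_nonneg _).trans (hK 0), fun n x => ?_⟩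
    rw [fderiv_comp_smul, norm_smul, norm_inv, Real.norm_of_nonneg (hn n).le,
      ← div_eq_mul_inv, le_div_iff₀ (by positivity)]
    have h := hK (((n : ℝ) + 1)⁻¹ • x)
    simp only [Pi.smul_apply', norm_smul, norm_inv, Real.norm_of_nonneg (hn n).le] at h
    rw [Real.norm_of_nonneg (by positivity)] at h
    refine le_trans (le_of_eq ?_) h
    field_simp

/-- Integration by parts on the whole plane against a bounded potential whose field decays
quadratically. -/
lemma tendsto_integral_fderiv_cutoff_mul {φ : ℕ → E2 → ℝ} {h : E2 → ℝ} {E : E2 → E2}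
    {B C K : ℝ} (hφ : ∀ n, ContDiff ℝ 1 (φ n)) (hφ1 : ∀ n x, |φ n x| ≤ 1)
    (hφl : ∀ x, ∀ᶠ n in Filter.atTop, φ n x = 1)
    (hφK : ∀ (n : ℕ) (x : E2), ‖fderiv ℝ (φ n) x‖ ≤ K * (n + 1 + ‖x‖)⁻¹) (hK : 0 ≤ K)
    (hh : ∀ x, HasGradientAt h (E x) x) (hE : Continuous E) (hB : ∀ x, |h x| ≤ B)
    (hC : ∀ x, ‖E x‖ ≤ C * (1 + ‖x‖)⁻¹ ^ 2) :
    Filter.Tendsto (fun n => ∫ x, fderiv ℝ (fun y => φ n y * h y) x (E x)) Filter.atTop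
      (nhds (∫ x, ‖E x‖ ^ 2)) := by
  have hB0 : 0 ≤ B := (abs_nonneg _).trans (hB 0)
  have hC0 : 0 ≤ C := by simpa using (norm_nonneg _).trans (hC 0)
  have hcont : Continuous h := continuous_iff_continuousAt.2 fun x => (hh x).continuousAt
  have hfd (n : ℕ) (x : E2) : fderiv ℝ (fun y => φ n y * h y) x (E x) =
      φ n x * ‖E x‖ ^ 2 + h x * fderiv ℝ (φ n) x (E x) := by
    rw [fderiv_fun_mul ((hφ n).differentiable one_ne_zero x) (hh x).differentiableAt,
      (hh x).hasFDerivAt.fderiv]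
    simp
  have hint : Integrable fun x : E2 => (C ^ 2 + B * K * C) * (1 + ‖x‖)⁻¹ ^ 3 := by
    refine Integrable.const_mul ?_ _
    have := integrable_one_add_norm (E := E2) (μ := volume) (r := 3) (by simp; norm_num)
    refine this.congr (ae_of_all _ fun x => ?_)
    dsimp only
    rw [Real.rpow_neg (by positivity), inv_pow]
    norm_cast
  simp only [hfd]
  refine tendsto_integral_of_dominated_convergence
    (fun x => (C ^ 2 + B * K * C) * (1 + ‖x‖)⁻¹ ^ 3) (fun n => ?_) hint (fun n => ?_) ?_
  · have := (hφ n).continuous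
    have := ((hφ n).continuous_fderiv one_ne_zero).clm_apply hE
    exact Continuous.aestronglyMeasurable (by fun_prop)
  · refine ae_of_all _ fun x => ?_
    have ht0 : 0 ≤ (1 + ‖x‖)⁻¹ := by positivity
    have ht1 : (1 + ‖x‖)⁻¹ ≤ 1 := inv_le_one_of_one_le₀ (by linarith [norm_nonneg x])
    have hKn : ‖fderiv ℝ (φ n) x‖ ≤ K * (1 + ‖x‖)⁻¹ := by
      refine (hφK n x).trans ?_
      gcongr
      linarith [(Nat.cast_nonneg n : (0 : ℝ) ≤ n)]
    have hCx := hC x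
    generalize (1 + ‖x‖)⁻¹ = t at *
    have h1 : |φ n x * ‖E x‖ ^ 2| ≤ 1 * (C * t ^ 2) ^ 2 := by
      rw [abs_mul, abs_of_nonneg (sq_nonneg ‖E x‖)]
      gcongr
      exact hφ1 n x
    have h2 : |h x * fderiv ℝ (φ n) x (E x)| ≤ B * (K * t * (C * t ^ 2)) := by
      rw [abs_mul]
      gcongr
      · exact hB x
      · exact ((fderiv ℝ (φ n) x).le_opNorm _).trans (by gcongr)
    have h3 : t ^ 4 ≤ t ^ 3 := pow_le_pow_of_le_one ht0 ht1 (by norm_num)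
    calc _ ≤ 1 * (C * t ^ 2) ^ 2 + B * (K * t * (C * t ^ 2)) :=
          (abs_add_le _ _).trans (add_le_add h1 h2)
      _ = C ^ 2 * t ^ 4 + B * K * C * t ^ 3 := by ring
      _ ≤ C ^ 2 * t ^ 3 + B * K * C * t ^ 3 := by gcongr
      _ = _ := by ring
  · refine ae_of_all _ fun x => ?_
    have h1 : Filter.Tendsto (fun n => φ n x * ‖E x‖ ^ 2) Filter.atTop (nhds (‖E x‖ ^ 2)) := by
      refine tendsto_const_nhds.congr' ?_
      filter_upwards [hφl x] with n hn
      rw [hn, one_mul]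
    have h0 : Filter.Tendsto (fun n : ℕ => K * ((n : ℝ) + 1 + ‖x‖)⁻¹ * ‖E x‖) Filter.atTop
        (nhds 0) := by
      have : Filter.Tendsto (fun n : ℕ => ((n : ℝ) + 1 + ‖x‖)) Filter.atTop Filter.atTop :=
        Filter.tendsto_atTop_add_const_right _ _
          (Filter.tendsto_atTop_add_const_right _ _ tendsto_natCast_atTop_atTop)
      simpa using (this.inv_tendsto_atTop.const_mul K).mul_const ‖E x‖
    have h2 : Filter.Tendsto (fun n => fderiv ℝ (φ n) x (E x)) Filter.atTop (nhds 0) :=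
      squeeze_zero_norm (fun n => ((fderiv ℝ (φ n) x).le_opNorm _).trans
        (mul_le_mul_of_nonneg_right (hφK n x) (norm_nonneg _))) h0
    simpa using h1.add (h2.const_mul (h x))

lemma tendsto_integral_cutoff_mul_udisc {lam : ℝ} (hlam : 0 < lam) (a : E2)
    {φ : ℕ → E2 → ℝ} {h : E2 → ℝ} (hφ : ∀ n, Continuous (φ n)) (hφ1 : ∀ n x, |φ n x| ≤ 1)
    (hφl : ∀ x, ∀ᶠ n in Filter.atTop, φ n x = 1) (hh : Continuous h) :
    Filter.Tendsto (fun n => ∫ x, φ n x * h x ∂(udisc a lam)) Filter.atTop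
      (nhds (∫ x, h x ∂(udisc a lam))) := by
  refine tendsto_integral_of_dominated_convergence (fun x => |h x|)
    (fun n => ((hφ n).mul hh).aestronglyMeasurable) (integrable_udisc hlam a hh.abs)
    (fun n => ae_of_all _ fun x => ?_) (ae_of_all _ fun x => ?_)
  · rw [norm_mul]
    exact mul_le_of_le_one_left (norm_nonneg _) (hφ1 n x)
  · refine tendsto_const_nhds.congr' ?_
    filter_upwards [hφl x] with n hn
    rw [hn, one_mul]

/-- The electric field generated by the configuration `(X, Y)`. -/
def efield (N : ℕ) (lam : ℝ) (X Y : Fin N → E2) (x : E2) : E2 :=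
  ∑ i, (discField lam (x - Y i) - discField lam (x - X i))

lemma hpot_eq {N : ℕ} {lam : ℝ} (hlam : 0 < lam) (X Y : Fin N → E2) :
    hpot N lam X Y = fun x =>
      ∑ i, (discProfile lam (‖x - X i‖ ^ 2) - discProfile lam (‖x - Y i‖ ^ 2)) := by
  ext x
  simp only [hpot, integral_gfun_sub_udisc hlam]

lemma hasGradientAt_hpot {N : ℕ} {lam : ℝ} (hlam : 0 < lam) (X Y : Fin N → E2) (x : E2) :
    HasGradientAt (hpot N lam X Y) (efield N lam X Y x) x := by
  rw [hpot_eq hlam, hasGradientAt_iff_hasFDerivAt, efield, map_sum]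
  refine HasFDerivAt.fun_sum fun i _ => ?_
  convert! (hasGradientAt_discProfile_sub hlam (X i) x).hasFDerivAt.sub
    (hasGradientAt_discProfile_sub hlam (Y i) x).hasFDerivAt using 1
  rw [← map_sub, neg_sub_neg]

lemma continuous_efield {N : ℕ} {lam : ℝ} (hlam : 0 < lam) (X Y : Fin N → E2) :
    Continuous (efield N lam X Y) := by
  have := (lipschitzWith_discField hlam).continuous
  unfold efield
  fun_prop

lemma contDiff_hpot {N : ℕ} {lam : ℝ} (hlam : 0 < lam) (X Y : Fin N → E2) :
    ContDiff ℝ 1 (hpot N lam X Y) := by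
  refine contDiff_one_iff_fderiv.2
    ⟨fun x => (hasGradientAt_hpot hlam X Y x).differentiableAt, ?_⟩
  have : fderiv ℝ (hpot N lam X Y) =
      fun x => InnerProductSpace.toDual ℝ E2 (efield N lam X Y x) :=
    funext fun x => (hasGradientAt_hpot hlam X Y x).hasFDerivAt.fderiv
  rw [this]
  exact (InnerProductSpace.toDual ℝ E2).continuous.comp (continuous_efield hlam X Y)

lemma exists_abs_hpot_le {N : ℕ} {lam : ℝ} (hlam : 0 < lam) (X Y : Fin N → E2) :
    ∃ B, ∀ x, |hpot N lam X Y x| ≤ B := by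
  refine ⟨∑ i, lam⁻¹ * ‖Y i - X i‖, fun x => ?_⟩
  rw [hpot_eq hlam]
  exact (Finset.abs_sum_le_sum_abs _ _).trans
    (Finset.sum_le_sum fun i _ => abs_discProfile_sub_le hlam (X i) (Y i) x)

lemma exists_norm_efield_le {N : ℕ} {lam : ℝ} (hlam : 0 < lam) (X Y : Fin N → E2) :
    ∃ C, ∀ x, ‖efield N lam X Y x‖ ≤ C * (1 + ‖x‖)⁻¹ ^ 2 := by
  choose C hC using fun i => exists_norm_discField_sub_discField_le hlam (Y i) (X i)
  refine ⟨∑ i, C i, fun x => ?_⟩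
  rw [Finset.sum_mul]
  exact (norm_sum_le _ _).trans (Finset.sum_le_sum fun i _ => hC i x)

lemma integrable_norm_efield_sq {N : ℕ} {lam : ℝ} (hlam : 0 < lam) (X Y : Fin N → E2) :
    Integrable fun x => ‖efield N lam X Y x‖ ^ 2 := by
  obtain ⟨C, hC⟩ := exists_norm_efield_le hlam X Y
  have := integrable_one_add_norm (E := E2) (μ := volume) (r := 4) (by simp; norm_num)
  refine (this.const_mul (C ^ 2)).mono'
    ((continuous_efield hlam X Y).norm.pow 2).aestronglyMeasurable (ae_of_all _ fun x => ?_)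
  rw [Real.rpow_neg (by positivity), Real.norm_of_nonneg (by positivity)]
  calc _ ≤ (C * (1 + ‖x‖)⁻¹ ^ 2) ^ 2 := by gcongr; exact hC x
    _ = C ^ 2 * ((1 + ‖x‖) ^ 4)⁻¹ := by rw [← inv_pow]; ring
    _ = _ := by norm_cast

lemma integral_fderiv_efield {N : ℕ} {lam : ℝ} (hlam : 0 < lam) (X Y : Fin N → E2) {g : E2 → ℝ}
    (hg : ContDiff ℝ 1 g) (hc : HasCompactSupport g) :
    ∫ x, fderiv ℝ g x (efield N lam X Y x) =
      2 * π * ∑ i, (∫ x, g x ∂(udisc (X i) lam) - ∫ x, g x ∂(udisc (Y i) lam)) := by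
  have hi (a : E2) : Integrable fun x => fderiv ℝ g x (discField lam (x - a)) := by
    refine Continuous.integrable_of_hasCompactSupport
      ((hg.continuous_fderiv one_ne_zero).clm_apply
        ((lipschitzWith_discField hlam).continuous.comp (by fun_prop))) ?_
    refine (hc.fderiv (𝕜 := ℝ)).mono fun x hx h0 => hx ?_
    simp [h0]
  simp only [efield, map_sum, map_sub]
  rw [integral_finsetSum _ fun i _ => (hi _).sub' (hi _), Finset.mul_sum]
  refine Finset.sum_congr rfl fun i _ => ?_
  rw [integral_sub (hi _) (hi _), integral_fderiv_discField hlam _ hg hc,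
    integral_fderiv_discField hlam _ hg hc]
  ring

/-- The Dirichlet energy of the potential equals `2π` times its integral against the charges. -/
lemma integral_norm_efield_sq {N : ℕ} {lam : ℝ} (hlam : 0 < lam) (X Y : Fin N → E2) :
    ∫ x, ‖efield N lam X Y x‖ ^ 2 = 2 * π * ∑ i,
      (∫ x, hpot N lam X Y x ∂(udisc (X i) lam) - ∫ x, hpot N lam X Y x ∂(udisc (Y i) lam)) := by
  obtain ⟨φ, hφ, hφc, hφ1, hφl, K, hK, hφK⟩ := exists_cutoff
  obtain ⟨B, hB⟩ := exists_abs_hpot_le hlam X Y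
  obtain ⟨C, hC⟩ := exists_norm_efield_le hlam X Y
  have hh := contDiff_hpot hlam X Y
  have h1 := tendsto_integral_fderiv_cutoff_mul hφ hφ1 hφl hφK hK (hasGradientAt_hpot hlam X Y)
    (continuous_efield hlam X Y) hB hC
  simp only [fun n => integral_fderiv_efield hlam X Y ((hφ n).mul hh) (hφc n).mul_right] at h1
  have h2 (a : E2) := tendsto_integral_cutoff_mul_udisc hlam a (fun n => (hφ n).continuous)
    hφ1 hφl hh.continuous
  exact tendsto_nhds_unique h1
    ((tendsto_finsetSum _ fun i _ => (h2 (X i)).sub (h2 (Y i))).const_mul _)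

lemma integral_hpot_udisc {N : ℕ} {lam : ℝ} (hlam : 0 < lam) (X Y : Fin N → E2) (a : E2) :
    ∫ x, hpot N lam X Y x ∂(udisc a lam) = ∑ j, (gsm lam (a - X j) - gsm lam (a - Y j)) := by
  have hi (b : E2) := integrable_udisc hlam a (continuous_discProfile_sub hlam b)
  simp only [hpot_eq hlam]
  rw [integral_finsetSum _ fun j _ => (hi _).sub' (hi _)]
  refine Finset.sum_congr rfl fun j _ => ?_
  rw [integral_sub (hi _) (hi _), integral_discProfile_sub_udisc hlam,
    integral_discProfile_sub_udisc hlam, ← gsm_neg hlam, neg_sub, ← gsm_neg hlam (Y j - a), neg_sub]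

lemma Flam_eq {N : ℕ} {lam : ℝ} (hlam : 0 < lam) (X Y : Fin N → E2) :
    Flam N lam X Y = (1 / (4 * π)) * (∫ x, ‖efield N lam X Y x‖ ^ 2) -
      N * (-Real.log lam + kappa) := by
  have hsymm : ∑ i, ∑ j, gsm lam (Y i - X j) = ∑ i, ∑ j, gsm lam (X i - Y j) := by
    rw [Finset.sum_comm]
    refine Finset.sum_congr rfl fun i _ => Finset.sum_congr rfl fun j _ => ?_
    rw [← gsm_neg hlam, neg_sub]
  rw [Flam, integral_norm_efield_sq hlam]
  simp only [integral_hpot_udisc hlam, Finset.sum_sub_distrib, Finset.sum_add_distrib, hsymm,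
    ← Finset.mul_sum]
  field_simp
  ring

/-- Electric rewriting of the energy (equation (1.14)). -/
theorem statement18 (N : ℕ) (hN : 1 ≤ N) (lam : ℝ) (hlam : 0 < lam)
    (X Y : Fin N → E2) :
    ContDiff ℝ 1 (hpot N lam X Y) ∧
      MeasureTheory.Integrable (fun x : E2 => ‖gradient (hpot N lam X Y) x‖ ^ 2) ∧
      Flam N lam X Y =
        (1 / (4 * Real.pi)) * (∫ x : E2, ‖gradient (hpot N lam X Y) x‖ ^ 2) -
          N * (-Real.log lam + kappa) := by
  have hgrad : gradient (hpot N lam X Y) = efield N lam X Y :=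
    funext fun x => (hasGradientAt_hpot hlam X Y x).gradient
  rw [hgrad]
  exact ⟨contDiff_hpot hlam X Y, integrable_norm_efield_sq hlam X Y, Flam_eq hlam X Y⟩
end
end
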